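/- arXiv:2009.07384 — 3 statements merged into one kernel-verified Lean document; each statement's English description precedes it below -/
import Mathlib

section
/- Fix an integer t ≥ 1 and a real ε with 0 ≤ ε ≤ 1/4. Let μ₋ (respectively μ₊) denote the product probability measure on {0,1}^t whose t coordinates are i.i.d. Bernoulli with success probability 1/2 − ε (respectively 1/2 + ε). Then for every function f : {0,1}^t → {true, false}, one has μ₋({ω : f(ω) = true}) + μ₊({ω : f(ω) = false}) ≥ (1/2)·exp(−16·t·ε²). -/
open MeasureTheory

/-- The Bernoulli measure on `Bool` with success probability `q`: mass `q` on `true`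
and mass `1 − q` on `false`. -/
noncomputable def bernoulliMeasure (q : ℝ) : Measure Bool :=
  ENNReal.ofReal q • Measure.dirac true + ENNReal.ofReal (1 - q) • Measure.dirac false

instance (q : ℝ) : IsFiniteMeasure (bernoulliMeasure q) := by
  constructor
  have : bernoulliMeasure q Set.univ =
      ENNReal.ofReal q + ENNReal.ofReal (1 - q) := by
    simp [bernoulliMeasure]
  rw [this]
  exact ENNReal.add_lt_top.2 ⟨ENNReal.ofReal_lt_top, ENNReal.ofReal_lt_top⟩

open scoped Classical in
/-- The sum of the errors of any test between two probability measures on a finite space is at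
least half the square of their Bhattacharyya coefficient. -/
theorem half_sq_bhattacharyya_le {α : Type*} [Fintype α] [MeasurableSpace α]
    [MeasurableSingletonClass α] (μ ν : Measure α) [IsProbabilityMeasure μ]
    [IsProbabilityMeasure ν] (s : Set α) :
    1 / 2 * (∑ x, √(μ.real {x} * ν.real {x})) ^ 2 ≤ μ.real s + ν.real sᶜ := by
  have measureReal_eq_sum (ρ : Measure α) [IsProbabilityMeasure ρ] (u : Set α) :
      ρ.real u = ∑ x, if x ∈ u then ρ.real {x} else 0 := by
    rw [← Finset.sum_filter, sum_measureReal_singleton]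
    simp
  have hsplit : ∑ x, √(μ.real {x} * ν.real {x}) =
      ∑ x, √(if x ∈ s then μ.real {x} else ν.real {x}) *
        √(if x ∈ s then ν.real {x} else μ.real {x}) := by
    refine Finset.sum_congr rfl fun x _ => ?_
    split_ifs
    · rw [Real.sqrt_mul measureReal_nonneg]
    · rw [Real.sqrt_mul measureReal_nonneg, mul_comm]
  have herr : μ.real s + ν.real sᶜ = ∑ x, if x ∈ s then μ.real {x} else ν.real {x} := by
    rw [measureReal_eq_sum μ, measureReal_eq_sum ν, ← Finset.sum_add_distrib]
    refine Finset.sum_congr rfl fun x _ => ?_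
    by_cases hx : x ∈ s <;> simp [hx]
  have hcompl : ν.real s + μ.real sᶜ = ∑ x, if x ∈ s then ν.real {x} else μ.real {x} := by
    rw [measureReal_eq_sum μ, measureReal_eq_sum ν, ← Finset.sum_add_distrib]
    refine Finset.sum_congr rfl fun x _ => ?_
    by_cases hx : x ∈ s <;> simp [hx]
  have hcs := Finset.sum_mul_sq_le_sq_mul_sq Finset.univ
    (fun x => √(if x ∈ s then μ.real {x} else ν.real {x}))
    (fun x => √(if x ∈ s then ν.real {x} else μ.real {x}))
  have hsq (a b : α → ℝ) (ha : ∀ x, 0 ≤ a x) (hb : ∀ x, 0 ≤ b x) :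
      ∑ x, √(if x ∈ s then a x else b x) ^ 2 = ∑ x, if x ∈ s then a x else b x := by
    refine Finset.sum_congr rfl fun x _ => Real.sq_sqrt ?_
    split_ifs
    exacts [ha x, hb x]
  rw [hsq _ _ (fun _ => measureReal_nonneg) (fun _ => measureReal_nonneg),
    hsq _ _ (fun _ => measureReal_nonneg) (fun _ => measureReal_nonneg),
    ← hsplit, ← herr, ← hcompl] at hcs
  have hμ : μ.real sᶜ ≤ 1 := measureReal_le_one
  have hν : ν.real s ≤ 1 := measureReal_le_one
  have hnonneg : 0 ≤ μ.real s + ν.real sᶜ := by positivity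
  nlinarith

theorem bernoulliMeasure_real_singleton {q : ℝ} (h0 : 0 ≤ q) (h1 : q ≤ 1) (b : Bool) :
    (bernoulliMeasure q).real {b} = if b then q else 1 - q := by
  cases b <;> simp [bernoulliMeasure, measureReal_def, h0, h1]

theorem isProbabilityMeasure_bernoulliMeasure {q : ℝ} (h0 : 0 ≤ q) (h1 : q ≤ 1) :
    IsProbabilityMeasure (bernoulliMeasure q) := by
  constructor
  simp [bernoulliMeasure, ← ENNReal.ofReal_add h0 (sub_nonneg.2 h1)]

/-- The Bhattacharyya coefficient is multiplicative over finite products. -/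
theorem sum_sqrt_pi_singleton {ι α : Type*} [Fintype ι] [DecidableEq ι] [Fintype α]
    [MeasurableSpace α] (μ ν : Measure α) [IsFiniteMeasure μ] [IsFiniteMeasure ν] :
    ∑ ω : ι → α, √((Measure.pi fun _ => μ).real {ω} * (Measure.pi fun _ => ν).real {ω}) =
      (∑ x, √(μ.real {x} * ν.real {x})) ^ Fintype.card ι := by
  rw [← Finset.card_univ, ← Finset.prod_const, Finset.prod_univ_sum, Fintype.piFinset_univ]
  refine Finset.sum_congr rfl fun ω _ => ?_
  simp only [measureReal_def, Measure.pi_singleton, ENNReal.toReal_prod]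
  rw [← Finset.prod_mul_distrib, Real.sqrt_prod]
  intros
  positivity

theorem exp_neg_four_mul_le_one_sub {x : ℝ} (h0 : 0 ≤ x) (h1 : x ≤ 3 / 4) :
    Real.exp (-(4 * x)) ≤ 1 - x := by
  rw [Real.exp_neg]
  refine inv_le_of_inv_le₀ (by linarith) ?_
  refine le_trans ?_ (Real.add_one_le_exp (4 * x))
  rw [inv_le_iff_one_le_mul₀ (by linarith)]
  nlinarith

/-- Bretagnolle–Huber-type hypothesis-testing lower bound: for any decision rule `f` based
on `t` i.i.d. samples, the sum of the error probabilities under `Bernoulli(1/2 − ε)^{⊗t}`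
and `Bernoulli(1/2 + ε)^{⊗t}` is at least `(1/2)·exp(−16·t·ε²)`. -/
theorem bretagnolle_huber_bernoulli
    (t : ℕ) (ht : 1 ≤ t) (ε : ℝ) (h0 : 0 ≤ ε) (h1 : ε ≤ 1 / 4)
    (f : (Fin t → Bool) → Bool) :
    ENNReal.ofReal ((1 / 2) * Real.exp (-16 * t * ε ^ 2)) ≤
      Measure.pi (fun _ : Fin t => bernoulliMeasure (1 / 2 - ε)) {ω | f ω = true} +
        Measure.pi (fun _ : Fin t => bernoulliMeasure (1 / 2 + ε)) {ω | f ω = false} := by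
  have := isProbabilityMeasure_bernoulliMeasure (q := 1 / 2 - ε) (by linarith) (by linarith)
  have := isProbabilityMeasure_bernoulliMeasure (q := 1 / 2 + ε) (by linarith) (by linarith)
  have hcompl : {ω | f ω = false} = {ω | f ω = true}ᶜ := by ext; simp
  have hcoeff : (∑ b, √((bernoulliMeasure (1 / 2 - ε)).real {b} *
      (bernoulliMeasure (1 / 2 + ε)).real {b})) ^ 2 = 1 - 4 * ε ^ 2 := by
    have hfalse : (1 - (1 / 2 - ε)) * (1 - (1 / 2 + ε)) = (1 / 2 - ε) * (1 / 2 + ε) := by ring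
    simp only [bernoulliMeasure_real_singleton (q := 1 / 2 - ε) (by linarith) (by linarith),
      bernoulliMeasure_real_singleton (q := 1 / 2 + ε) (by linarith) (by linarith),
      Fintype.sum_bool, if_true, Bool.false_eq_true, if_false, hfalse]
    rw [← two_mul, mul_pow, Real.sq_sqrt (mul_nonneg (by linarith) (by linarith))]
    ring
  have hexp : Real.exp (-16 * t * ε ^ 2) ≤ (1 - 4 * ε ^ 2) ^ t := by
    rw [show -16 * t * ε ^ 2 = t * -(4 * (4 * ε ^ 2)) by ring, Real.exp_nat_mul]
    gcongr
    exact exp_neg_four_mul_le_one_sub (by positivity) (by nlinarith)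
  have key := half_sq_bhattacharyya_le (Measure.pi fun _ : Fin t => bernoulliMeasure (1 / 2 - ε))
    (Measure.pi fun _ : Fin t => bernoulliMeasure (1 / 2 + ε)) {ω | f ω = true}
  rw [sum_sqrt_pi_singleton, Fintype.card_fin, ← pow_mul, mul_comm t 2, pow_mul, hcoeff] at key
  rw [hcompl, ← ofReal_measureReal, ← ofReal_measureReal (s := {ω | f ω = true}ᶜ),
    ← ENNReal.ofReal_add measureReal_nonneg measureReal_nonneg]
  exact ENNReal.ofReal_le_ofReal (by linarith)
end

section
/- Let γ > 0 be a real number and t ≥ 2 an integer such that ε := √(γ·log t / (16·t)) satisfies ε ≤ 1/4. Let μ₋ (respectively μ₊) denote the product probability measure on {0,1}^t whose t coordinates are i.i.d. Bernoulli with success probability 1/2 − ε (respectively 1/2 + ε). Then for every function f : {0,1}^t → {true, false}, one has max( μ₋({ω : f(ω) = true}), μ₊({ω : f(ω) = false}) ) ≥ (1/4)·t^{−γ}. Consequently, no decision rule based on t samples can, under both hypotheses simultaneously, identify the better of the two arms with probability exceeding 1 − (1/4)·t^{−γ}. -/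
open MeasureTheory

theorem bernoulliMeasure_singleton_true (q : ℝ) :
    bernoulliMeasure q {true} = ENNReal.ofReal q := by
  simp [bernoulliMeasure]

theorem bernoulliMeasure_singleton_false (q : ℝ) :
    bernoulliMeasure q {false} = ENNReal.ofReal (1 - q) := by
  simp [bernoulliMeasure]

/-- The product of the point masses under `Bernoulli(q)` and `Bernoulli(1 − q)` does not depend
on the point. -/
theorem bernoulliMeasure_real_mul {q : ℝ} (h0 : 0 ≤ q) (h1 : q ≤ 1) (b : Bool) :
    (bernoulliMeasure q).real {b} * (bernoulliMeasure (1 - q)).real {b} = q * (1 - q) := by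
  have h2 : 0 ≤ 1 - q := sub_nonneg.2 h1
  cases b
  · simp [measureReal_def, bernoulliMeasure_singleton_false, h0, h2, mul_comm]
  · simp [measureReal_def, bernoulliMeasure_singleton_true, h0, h2]

/-- Le Cam's two-point bound: the sum of the two error probabilities of a test is at least half
the squared Bhattacharyya coefficient. -/
theorem sq_sum_le_two_mul_error {Ω : Type*} [Fintype Ω] [MeasurableSpace Ω]
    [MeasurableSingletonClass Ω] (μ ν : Measure Ω) [IsProbabilityMeasure μ]
    [IsProbabilityMeasure ν] (r : Ω → ℝ) (hr : ∀ ω, r ω ^ 2 = μ.real {ω} * ν.real {ω})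
    (f : Ω → Bool) :
    (∑ ω, r ω) ^ 2 ≤ 2 * (μ.real {ω | f ω = true} + ν.real {ω | f ω = false}) := by
  classical
  have hmeas (ρ : Measure Ω) [IsFiniteMeasure ρ] (b : Bool) :
      ρ.real {ω | f ω = b} = ∑ ω, if f ω = b then ρ.real {ω} else 0 := by
    rw [← Finset.sum_filter, sum_measureReal_singleton]
    simp
  have hcs := Finset.sum_sq_le_sum_mul_sum_of_sq_le_mul Finset.univ (r := r)
    (f := fun ω => (if f ω = true then μ.real {ω} else 0) +
      if f ω = false then ν.real {ω} else 0)
    (g := fun ω => (if f ω = false then μ.real {ω} else 0) +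
      if f ω = true then ν.real {ω} else 0)
    (fun ω _ => by positivity) (fun ω _ => by positivity)
    (fun ω _ => by cases h : f ω <;> simp [hr, mul_comm])
  simp only [Finset.sum_add_distrib, ← hmeas] at hcs
  have hμ : μ.real {ω | f ω = false} ≤ 1 := measureReal_le_one
  have hν : ν.real {ω | f ω = true} ≤ 1 := measureReal_le_one
  have h0 : 0 ≤ μ.real {ω | f ω = true} + ν.real {ω | f ω = false} := by positivity
  nlinarith

theorem exp_neg_le_one_sub_div_four {y : ℝ} (h0 : 0 ≤ y) (h1 : y ≤ 1) :
    Real.exp (-y) ≤ 1 - y / 4 := by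
  rw [Real.exp_neg]
  refine (inv_anti₀ (by linarith) (Real.add_one_le_exp y)).trans ?_
  rw [inv_le_iff_one_le_mul₀ (by linarith)]
  nlinarith

/-- Lower-bound instantiation: with `ε = √(γ·log t/(16t)) ≤ 1/4`, any decision rule `f`
based on `t` samples errs with probability at least `(1/4)·t^{−γ}` under one of the two
hypotheses `Bernoulli(1/2 − ε)^{⊗t}`, `Bernoulli(1/2 + ε)^{⊗t}`; hence no algorithm can
identify the better arm under both hypotheses with probability exceeding `1 − (1/4)·t^{−γ}`. -/
theorem bandit_lower_bound
    (γ : ℝ) (hγ : 0 < γ) (t : ℕ) (ht : 2 ≤ t)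
    (ε : ℝ) (hε : ε = Real.sqrt (γ * Real.log t / (16 * t))) (hε14 : ε ≤ 1 / 4)
    (f : (Fin t → Bool) → Bool) :
    ENNReal.ofReal ((1 / 4) * (t : ℝ) ^ (-γ)) ≤
      max (Measure.pi (fun _ : Fin t => bernoulliMeasure (1 / 2 - ε)) {ω | f ω = true})
        (Measure.pi (fun _ : Fin t => bernoulliMeasure (1 / 2 + ε)) {ω | f ω = false}) := by
  have hε0 : 0 ≤ ε := hε ▸ Real.sqrt_nonneg _
  have ht0 : (0 : ℝ) < t := by exact_mod_cast (by omega : 0 < t)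
  have hlog : 0 ≤ Real.log t := Real.log_natCast_nonneg t
  have hε2 : 16 * ε ^ 2 * t = γ * Real.log t := by
    rw [hε, Real.sq_sqrt (by positivity)]
    field_simp
  have hpow : (t : ℝ) ^ (-γ) ≤ (1 - 4 * ε ^ 2) ^ t := by
    calc (t : ℝ) ^ (-γ) = Real.exp (-(16 * ε ^ 2)) ^ t := by
          rw [Real.rpow_def_of_pos ht0, ← Real.exp_nat_mul]
          congr 1
          linarith
      _ ≤ (1 - 4 * ε ^ 2) ^ t := by
          gcongr
          have := exp_neg_le_one_sub_div_four (y := 16 * ε ^ 2) (by positivity) (by nlinarith)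
          linarith
  have := isProbabilityMeasure_bernoulliMeasure (q := 1 / 2 - ε) (by linarith) (by linarith)
  have := isProbabilityMeasure_bernoulliMeasure (q := 1 / 2 + ε) (by linarith) (by linarith)
  have hc : 0 ≤ 1 / 4 - ε ^ 2 := by nlinarith
  have herr := sq_sum_le_two_mul_error
    (Measure.pi fun _ : Fin t => bernoulliMeasure (1 / 2 - ε))
    (Measure.pi fun _ : Fin t => bernoulliMeasure (1 / 2 + ε))
    (fun _ => √(1 / 4 - ε ^ 2) ^ t) (fun ω => by
      have hmul (b : Bool) : (bernoulliMeasure (1 / 2 - ε)).real {b} *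
          (bernoulliMeasure (1 / 2 + ε)).real {b} = 1 / 4 - ε ^ 2 := by
        have h := bernoulliMeasure_real_mul (q := 1 / 2 - ε) (by linarith) (by linarith) b
        rw [show 1 - (1 / 2 - ε) = 1 / 2 + ε by ring] at h
        rw [h]
        ring
      simp only [measureReal_def, Measure.pi_singleton, ENNReal.toReal_prod] at hmul ⊢
      rw [← Finset.prod_mul_distrib, Finset.prod_congr rfl fun i _ => hmul (ω i), ← pow_mul,
        mul_comm t, pow_mul, Real.sq_sqrt hc]
      simp) f
  have hsum : (∑ _ω : Fin t → Bool, √(1 / 4 - ε ^ 2) ^ t) ^ 2 = (1 - 4 * ε ^ 2) ^ t := by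
    simp only [Finset.sum_const, Finset.card_univ, Fintype.card_pi, Fintype.card_bool,
      Finset.prod_const, Fintype.card_fin, nsmul_eq_mul, Nat.cast_pow, Nat.cast_ofNat]
    rw [← mul_pow, ← pow_mul, mul_comm t, pow_mul, mul_pow, Real.sq_sqrt hc]
    ring
  rw [hsum] at herr
  rw [le_max_iff, ← ofReal_measureReal, ← ofReal_measureReal,
    ENNReal.ofReal_le_ofReal_iff measureReal_nonneg,
    ENNReal.ofReal_le_ofReal_iff measureReal_nonneg]
  by_contra! h
  linarith [h.1, h.2]
end

section
/- Let X and Y be nonempty sets and let α̂, α, β, β̂ : X × Y → ℝ be bounded functions satisfying α̂(x,y) ≤ α(x,y) ≤ β(x,y) ≤ β̂(x,y) for all (x,y) ∈ X × Y. Suppose (x̲, y̲) ∈ X × Y is a saddle point of α̂, i.e., α̂(x, y̲) ≤ α̂(x̲, y̲) ≤ α̂(x̲, y) for all x ∈ X and y ∈ Y, with value α̂* := α̂(x̲, y̲); and suppose (x̄, ȳ) ∈ X × Y is a saddle point of β̂ with value β̂* := β̂(x̄, ȳ). Then the Nash gap of the pessimistic profile (x̲, ȳ) with respect to the bound pair (α,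 β), namely sup_{x∈X} β(x, ȳ) − inf_{y∈Y} α(x̲, y), is at most β̂* − α̂*. -/
/-- If `α̂ ≤ α ≤ β ≤ β̂` pointwise, `(x̲, y̲)` is a saddle point of `α̂` with value `α̂*`,
and `(x̄, ȳ)` is a saddle point of `β̂` with value `β̂*`, then the Nash gap of the
pessimistic profile `(x̲, ȳ)` with respect to `(α, β)` is at most `β̂* − α̂*`. -/
theorem nash_gap_of_pessimistic_profile
    {X Y : Type*} [Nonempty X] [Nonempty Y]
    (αhat α β βhat : X → Y → ℝ)
    (hbdd : ∃ C : ℝ, ∀ x y,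
      |αhat x y| ≤ C ∧ |α x y| ≤ C ∧ |β x y| ≤ C ∧ |βhat x y| ≤ C)
    (hsandwich : ∀ x y, αhat x y ≤ α x y ∧ α x y ≤ β x y ∧ β x y ≤ βhat x y)
    (xlo : X) (ylo : Y)
    (hlo : ∀ x y, αhat x ylo ≤ αhat xlo ylo ∧ αhat xlo ylo ≤ αhat xlo y)
    (xhi : X) (yhi : Y)
    (hhi : ∀ x y, βhat x yhi ≤ βhat xhi yhi ∧ βhat xhi yhi ≤ βhat xhi y) :
    (⨆ x, β x yhi) - (⨅ y, α xlo y) ≤ βhat xhi yhi - αhat xlo ylo := by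
  exact sub_le_sub
    (ciSup_le fun x => (hsandwich x yhi).2.2.trans (hhi x ylo).1)
    (le_ciInf fun y => (hlo xlo y).2.trans (hsandwich xlo y).1)
end
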